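/- For every integer q ≥ 1 and every real t > 0 there exists a compactly supported probability measure ν on ℝ such that for every n ≥ 1, ∫ x^n dν(x) = Σ_{b=1}^{n} F_q^b(n)·t^b, where F_q^b(n) = (1/b)·(n−1 choose b−1)·(qn choose b−1) is the Fuss–Narayana number. -/

import Mathlib

open MeasureTheory

/-- The Fuss–Narayana number `F_q^b(n) = (1/b) * (n-1 choose b-1) * (qn choose b-1)`,
as a real number. -/
noncomputable def fussNarayana (q n b : ℕ) : ℝ :=
  (1 / (b : ℝ)) * (Nat.choose (n - 1) (b - 1) : ℝ) * (Nat.choose (q * n) (b - 1) : ℝ)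

section Lagrange
open PowerSeries

theorem exists_powerSeries_fixedPoint {R : Type*} [CommRing R] (φ : Polynomial R) :
    ∃ z : R⟦X⟧, z = X * φ.aeval z := by
  let s : ℕ → R⟦X⟧ := fun k => (fun w => X * φ.aeval w)^[k] 0
  have hs : ∀ k, s (k + 1) = X * φ.aeval (s k) := fun k =>
    Function.iterate_succ_apply' _ _ _
  have hsub : ∀ a b : R⟦X⟧, a - b ∣ φ.aeval a - φ.aeval b := fun a b => by
    simpa [Polynomial.aeval_def, Polynomial.eval_map] using
      Polynomial.sub_dvd_eval_sub a b (φ.map (algebraMap R R⟦X⟧))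
  have hstep : ∀ k, (X : R⟦X⟧) ^ k ∣ s (k + 1) - s k := by
    intro k
    induction k with
    | zero => simp
    | succ k ih =>
      have h : s (k + 2) - s (k + 1) = X * (φ.aeval (s (k + 1)) - φ.aeval (s k)) := by
        rw [mul_sub, ← hs, ← hs]
      rw [h, pow_succ']
      exact mul_dvd_mul_left _ (ih.trans (hsub _ _))
  have hcoeff : ∀ n k, n < k → coeff n (s k) = coeff n (s (n + 1)) := by
    intro n k hk
    induction k, hk using Nat.le_induction with
    | base => rfl
    | succ k hk ih =>
      rw [← ih, ← sub_eq_zero, ← map_sub]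
      exact X_pow_dvd_iff.1 (hstep k) n hk
  let z : R⟦X⟧ := mk fun n => coeff n (s (n + 1))
  have hz : ∀ k, (X : R⟦X⟧) ^ k ∣ z - s k := by
    intro k
    rw [X_pow_dvd_iff]
    intro m hm
    rw [map_sub, coeff_mk, hcoeff m k hm, sub_self]
  refine ⟨z, ?_⟩
  ext n
  rw [← sub_eq_zero, ← map_sub]
  refine (X_pow_dvd_iff (n := n + 1)).1 ?_ n n.lt_succ_self
  have h1 := (hz n).trans (hsub z (s n))
  have h2 : (X : R⟦X⟧) ^ (n + 1) ∣ X * φ.aeval z - s (n + 1) := by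
    rw [hs, ← mul_sub, pow_succ']
    exact mul_dvd_mul_left _ h1
  simpa using dvd_sub (hz (n + 1)) h2

/-- The form of Lagrange inversion that is stable under induction. -/
theorem coeff_aeval_mul_eq_coeff_mul_pow {R : Type*} [CommRing R] [IsDomain R] [CharZero R]
    (φ : Polynomial R) {z d : R⟦X⟧} (hz : z = X * φ.aeval z)
    (hd : d * (1 - X * φ.derivative.aeval z) = 1) (n : ℕ) (k : Polynomial R) :
    coeff n (k.aeval z * d) = (k * φ ^ n).coeff n := by
  have hd' : d = 1 + X * (φ.derivative.aeval z * d) := by linear_combination hd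
  have hz0 : constantCoeff z = 0 := by rw [hz]; simp
  induction n generalizing k with
  | zero =>
    have hd0 : constantCoeff d = 1 := by rw [hd']; simp
    have hk : constantCoeff (k.aeval z) = k.coeff 0 := by
      conv_lhs => rw [← Polynomial.divX_mul_X_add k]
      simp [hz0]
    simp [hd0, hk]
  | succ n ih =>
    have hX : ∀ p : Polynomial R,
        coeff (n + 1) ((p * Polynomial.X).aeval z * d) =
          (p * Polynomial.X * φ ^ (n + 1)).coeff (n + 1) := by
      intro p
      have h1 : (p * Polynomial.X).aeval z * d = X * ((p * φ).aeval z * d) := by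
        rw [map_mul, map_mul, Polynomial.aeval_X]
        linear_combination p.aeval z * d * hz
      rw [h1, coeff_succ_X_mul, ih,
        show p * Polynomial.X * φ ^ (n + 1) = (p * φ * φ ^ n) * Polynomial.X by ring,
        Polynomial.coeff_mul_X]
    have h1 : coeff (n + 1) d = (φ ^ (n + 1)).coeff (n + 1) := by
      have h2 : coeff (n + 1) d = (φ.derivative * φ ^ n).coeff n := by
        conv_lhs => rw [hd']
        rw [map_add, coeff_succ_X_mul, ih]
        simp [coeff_one]
      have h3 := Polynomial.coeff_derivative (φ ^ (n + 1)) n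
      rw [Polynomial.derivative_pow_succ, mul_assoc, mul_comm (φ ^ n), Polynomial.coeff_C_mul] at h3
      have hn : ((n : R) + 1) ≠ 0 := by exact_mod_cast n.succ_ne_zero
      rw [h2]
      exact mul_left_cancel₀ hn (by rw [h3]; ring)
    conv_lhs => rw [← Polynomial.divX_mul_X_add k]
    conv_rhs => rw [← Polynomial.divX_mul_X_add k]
    rw [map_add, add_mul, map_add, hX, add_mul, Polynomial.coeff_add, Polynomial.aeval_C,
      Polynomial.coeff_C_mul, ← h1, ← Algebra.smul_def, coeff_smul, smul_eq_mul]

/-- **Lagrange inversion** for a polynomial `φ`. -/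
theorem lagrange_inversion {R : Type*} [Field R] [CharZero R]
    (φ : Polynomial R) {z : R⟦X⟧} (hz : z = X * φ.aeval z) (n : ℕ) :
    ((n : R) + 1) * coeff (n + 1) z = (φ ^ (n + 1)).coeff n := by
  have hu : IsUnit (1 - X * φ.derivative.aeval z) := by
    rw [PowerSeries.isUnit_iff_constantCoeff]; simp
  obtain ⟨d, hd⟩ := hu.exists_left_inv
  have hder : derivative R z = φ.aeval z * d := by
    have h1 : derivative R z = φ.aeval z + X * (φ.derivative.aeval z * derivative R z) := by
      conv_lhs => rw [hz]
      rw [Derivation.leibniz, Derivation.map_aeval]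
      simp
      ring
    linear_combination (-derivative R z) * hd + d * h1
  rw [pow_succ', ← coeff_aeval_mul_eq_coeff_mul_pow φ hz hd, ← hder]
  rw [coeff_derivative, mul_comm]

end Lagrange

section Kernel
open PowerSeries

/-- A power series in the outer variable of `ℝ⟦X⟧⟦X⟧`. -/
noncomputable def outerSeries : ℝ⟦X⟧ →+* ℝ⟦X⟧⟦X⟧ := PowerSeries.map C

/-- A power series in the inner variable of `ℝ⟦X⟧⟦X⟧`. -/
noncomputable def innerSeries : ℝ⟦X⟧ →+* ℝ⟦X⟧⟦X⟧ := C

theorem constantCoeff_outerSeries (g : ℝ⟦X⟧) :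
    constantCoeff (outerSeries g) = C (constantCoeff g) := by
  rw [outerSeries, ← coeff_zero_eq_constantCoeff_apply, coeff_map,
    coeff_zero_eq_constantCoeff_apply]

/-- The rank-one kernel `g(u) g(v)`. -/
noncomputable def rankOne : ℝ⟦X⟧ →* ℝ⟦X⟧⟦X⟧ :=
  outerSeries.toMonoidHom * innerSeries.toMonoidHom

theorem rankOne_apply (g : ℝ⟦X⟧) : rankOne g = outerSeries g * innerSeries g := rfl

theorem coeff_coeff_rankOne (g : ℝ⟦X⟧) (i j : ℕ) :
    coeff j (coeff i (rankOne g)) = coeff i g * coeff j g := by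
  simp [rankOne_apply, outerSeries, innerSeries]

/-- Finite sums of rank-one kernels. -/
noncomputable def sumRankOne : Subsemiring ℝ⟦X⟧⟦X⟧ :=
  (MonoidHom.mrange rankOne).subsemiringClosure

theorem rankOne_mem (g : ℝ⟦X⟧) : rankOne g ∈ sumRankOne := by
  rw [sumRankOne, ← Subsemiring.mem_toAddSubmonoid, Submonoid.subsemiringClosure_toAddSubmonoid]
  exact AddSubmonoid.subset_closure ⟨g, rfl⟩

theorem sumRankOne_quadratic_nonneg {s : ℝ⟦X⟧⟦X⟧} (hs : s ∈ sumRankOne) (N : ℕ) (c : ℕ → ℝ) :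
    0 ≤ ∑ i ∈ Finset.range N, ∑ j ∈ Finset.range N, c i * c j * coeff j (coeff i s) := by
  have hs' : s ∈ AddSubmonoid.closure (MonoidHom.mrange rankOne : Set ℝ⟦X⟧⟦X⟧) := by
    rwa [← Submonoid.subsemiringClosure_toAddSubmonoid]
  induction hs' using AddSubmonoid.closure_induction with
  | mem x hx =>
    obtain ⟨g, rfl⟩ := hx
    have : ∑ i ∈ Finset.range N, ∑ j ∈ Finset.range N,
        c i * c j * coeff j (coeff i (rankOne g)) =
        (∑ i ∈ Finset.range N, c i * coeff i g) ^ 2 := by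
      rw [sq, Finset.sum_mul_sum]
      refine Finset.sum_congr rfl fun i _ => Finset.sum_congr rfl fun j _ => ?_
      rw [coeff_coeff_rankOne]; ring
    rw [this]; positivity
  | zero => simp
  | add x y hx hy ihx ihy =>
    rw [← Submonoid.subsemiringClosure_toAddSubmonoid] at hx hy
    simpa [mul_add, Finset.sum_add_distrib] using add_nonneg (ihx hx) (ihy hy)

/-- The ideal generated by the `N`-th powers of the two variables. -/
noncomputable def truncIdeal (N : ℕ) : Ideal ℝ⟦X⟧⟦X⟧ :=
  Ideal.span {outerSeries (X ^ N), innerSeries (X ^ N)}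

theorem coeff_coeff_eq_zero_of_mem_truncIdeal {N : ℕ} {f : ℝ⟦X⟧⟦X⟧} (hf : f ∈ truncIdeal N)
    {i j : ℕ} (hi : i < N) (hj : j < N) : coeff j (coeff i f) = 0 := by
  obtain ⟨a, b, rfl⟩ := Ideal.mem_span_pair.1 hf
  simp only [outerSeries, innerSeries, map_pow, map_X, map_add, coeff_mul_X_pow',
    hi.not_ge, if_false]
  simp [← map_pow, coeff_mul_X_pow', hj.not_ge]

theorem rankOne_mul_mem_truncIdeal {z : ℝ⟦X⟧} (hz : constantCoeff z = 0) {N : ℕ}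
    {f : ℝ⟦X⟧⟦X⟧} (hf : f ∈ truncIdeal N) : rankOne z * f ∈ truncIdeal (N + 1) := by
  obtain ⟨a, b, rfl⟩ := Ideal.mem_span_pair.1 hf
  obtain ⟨w, rfl⟩ := X_dvd_iff.2 hz
  refine Ideal.mem_span_pair.2 ⟨a * outerSeries w * innerSeries (X * w),
    b * outerSeries (X * w) * innerSeries w, ?_⟩
  simp only [rankOne_apply, map_mul, map_pow]
  ring

/-- Every truncation of the kernel is a finite sum of rank-one kernels. -/
def IsPSDKernel (f : ℝ⟦X⟧⟦X⟧) : Prop :=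
  ∀ N, ∃ s ∈ sumRankOne, f - s ∈ truncIdeal N

theorem IsPSDKernel.of_mem {s : ℝ⟦X⟧⟦X⟧} (hs : s ∈ sumRankOne) : IsPSDKernel s :=
  fun _ => ⟨s, hs, by simp⟩

theorem IsPSDKernel.add {f g : ℝ⟦X⟧⟦X⟧} (hf : IsPSDKernel f) (hg : IsPSDKernel g) :
    IsPSDKernel (f + g) := by
  intro N
  obtain ⟨s, hs, h⟩ := hf N
  obtain ⟨r, hr, h'⟩ := hg N
  exact ⟨s + r, add_mem hs hr, by convert add_mem h h' using 1; ring⟩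

theorem mul_sub_mul_mem_of_sub_mem {A : Type*} [CommRing A] {I : Ideal A} {f g s r : A}
    (h : f - s ∈ I) (h' : g - r ∈ I) : f * g - s * r ∈ I := by
  convert add_mem (I.mul_mem_right g h) (I.mul_mem_left s h') using 1; ring

theorem IsPSDKernel.mul {f g : ℝ⟦X⟧⟦X⟧} (hf : IsPSDKernel f) (hg : IsPSDKernel g) :
    IsPSDKernel (f * g) := by
  intro N
  obtain ⟨s, hs, h⟩ := hf N
  obtain ⟨r, hr, h'⟩ := hg N
  exact ⟨s * r, mul_mem hs hr, mul_sub_mul_mem_of_sub_mem h h'⟩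

theorem IsPSDKernel.quadratic_nonneg {f : ℝ⟦X⟧⟦X⟧} (hf : IsPSDKernel f) (N : ℕ) (c : ℕ → ℝ) :
    0 ≤ ∑ i ∈ Finset.range N, ∑ j ∈ Finset.range N, c i * c j * coeff j (coeff i f) := by
  obtain ⟨s, hs, h⟩ := hf N
  refine (sumRankOne_quadratic_nonneg hs N c).trans_eq ?_
  refine Finset.sum_congr rfl fun i hi => Finset.sum_congr rfl fun j hj => ?_
  have := coeff_coeff_eq_zero_of_mem_truncIdeal h (Finset.mem_range.1 hi) (Finset.mem_range.1 hj)
  rw [map_sub, map_sub, sub_eq_zero] at this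
  rw [this]

/-- The geometric series of the positive semidefinite kernel `z(u) z(v) W(u, v)`. -/
theorem IsPSDKernel.geometric {z : ℝ⟦X⟧} (hz : constantCoeff z = 0) {W E : ℝ⟦X⟧⟦X⟧}
    (hW : IsPSDKernel W) (hE : (1 - rankOne z * W) * E = 1) : IsPSDKernel E := by
  intro N
  induction N with
  | zero => exact ⟨0, zero_mem _, Ideal.mem_span_pair.2 ⟨E, 0, by simp⟩⟩
  | succ N ih =>
    obtain ⟨s, hs, h⟩ := hW N
    obtain ⟨r, hr, h'⟩ := ih
    refine ⟨1 + rankOne z * (s * r),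
      add_mem (one_mem _) (mul_mem (rankOne_mem z) (mul_mem hs hr)), ?_⟩
    convert rankOne_mul_mem_truncIdeal hz (mul_sub_mul_mem_of_sub_mem h h') using 1
    linear_combination hE

/-- With `φ w = (1 + w) ^ q * (t + w)`, the quotient `W` of the kernels `(φ x - φ y) / (x - y)` and
`(x * φ y - y * φ x) / (x - y)` is positive semidefinite. -/
theorem exists_psdKernel_factorization {t : ℝ} (ht : 0 < t) {z : ℝ⟦X⟧}
    (hz : constantCoeff z = 0) (q : ℕ) :
    let x := outerSeries z
    let y := innerSeries z
    let φ : ℝ⟦X⟧⟦X⟧ → ℝ⟦X⟧⟦X⟧ := fun w => (1 + w) ^ q * (C (C t) + w)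
    ∃ P W E : ℝ⟦X⟧⟦X⟧, P ≠ 0 ∧ IsPSDKernel W ∧ IsPSDKernel E ∧
      (1 - rankOne z * W) * E = 1 ∧
      (x - y) * P = x * φ y - y * φ x ∧
      (x - y) * (W * P) = φ x - φ y := by
  have hE : ∀ W : ℝ⟦X⟧⟦X⟧, ∃ E, (1 - rankOne z * W) * E = 1 := by
    intro W
    refine IsUnit.exists_right_inv ?_
    rw [PowerSeries.isUnit_iff_constantCoeff]
    simp [rankOne_apply, constantCoeff_outerSeries, hz]
  intro x y
  induction q with
  | zero =>
    intro φ
    have ht' : (C (C t⁻¹) : ℝ⟦X⟧⟦X⟧) * C (C t) = 1 := by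
      rw [← map_mul, ← map_mul, inv_mul_cancel₀ ht.ne', map_one, map_one]
    have hW : IsPSDKernel (C (C t⁻¹) : ℝ⟦X⟧⟦X⟧) := by
      convert IsPSDKernel.of_mem (rankOne_mem (C √t⁻¹)) using 1
      simp only [rankOne_apply, outerSeries, innerSeries, map_C, ← map_mul]
      rw [Real.mul_self_sqrt (by positivity)]
    obtain ⟨E, h⟩ := hE (C (C t⁻¹))
    refine ⟨C (C t), _, E, right_ne_zero_of_mul_eq_one ht', hW, hW.geometric hz h, h,
      ?_, ?_⟩
    · simp only [φ]; ring
    · rw [ht']; simp only [φ]; ring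
  | succ q ih =>
    obtain ⟨P, W, E, hP, hW, hE', h1, h2, h3⟩ := ih
    intro φ
    have hW' : IsPSDKernel (1 + rankOne (1 + z) * (W * E)) :=
      (IsPSDKernel.of_mem (one_mem _)).add
        ((IsPSDKernel.of_mem (rankOne_mem _)).mul (hW.mul hE'))
    obtain ⟨E', h⟩ := hE (1 + rankOne (1 + z) * (W * E))
    refine ⟨P * (1 - rankOne z * W), _, E', mul_ne_zero hP (left_ne_zero_of_mul_eq_one h1),
      hW', hW'.geometric hz h, h, ?_, ?_⟩
    · simp only [φ, pow_succ, rankOne_apply] at *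
      linear_combination h2 - x * y * h3
    · simp only [φ, pow_succ, rankOne_apply, map_add, map_one] at *
      linear_combination h2 + (1 + x + y) * h3 + (1 + x) * (1 + y) * (x - y) * W * P * h1

/-- The Hankel kernel of `1 + z` is positive semidefinite when
`z = X (1 + z) ^ (q + 1) (t + z)`. -/
theorem isPSDKernel_hankel {t : ℝ} (ht : 0 < t) (q : ℕ) {z : ℝ⟦X⟧}
    (hz : z = X * ((1 + z) ^ (q + 1) * (C t + z))) :
    IsPSDKernel (mk fun i => mk fun j => coeff (i + j) (1 + z)) := by
  have hz0 : constantCoeff z = 0 := by rw [hz]; simp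
  obtain ⟨P, W, E, hP, hW, hE, h1, h2, h3⟩ := exists_psdKernel_factorization ht hz0 q
  set H : ℝ⟦X⟧⟦X⟧ := mk fun i => mk fun j => coeff (i + j) (1 + z) with hH
  have hHank : (outerSeries X - innerSeries X) * H =
      outerSeries (X * (1 + z)) - innerSeries (X * (1 + z)) := by
    ext i j
    have hc : constantCoeff (PowerSeries.map C z) = (0 : ℝ⟦X⟧) := by
      rw [← outerSeries, constantCoeff_outerSeries, hz0, map_zero]
    simp only [outerSeries, innerSeries, map_X, map_mul, sub_mul, map_sub, coeff_C_mul, hH]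
    rcases i with _ | i <;> rcases j with _ | j
    · simp
    · simp [coeff_succ_X_mul, coeff_zero_X_mul]
    · simp [coeff_succ_X_mul, coeff_zero_X_mul]
    · rcases i with _ | i <;>
        simp [coeff_succ_X_mul, coeff_one, add_right_comm, add_assoc, add_comm 1, hc]
  have hx := congrArg outerSeries hz
  have hy := congrArg innerSeries hz
  have hCx : outerSeries (C t) = C (C t) := by simp [outerSeries]
  have hCy : innerSeries (C t) = C (C t) := rfl
  simp only [map_mul, map_add, map_pow, map_one, hCx, hCy] at hx hy hHank
  have hne : outerSeries z - innerSeries z ≠ 0 := by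
    intro h
    have h1 : coeff 1 z = t := by
      rw [hz, show (1 : ℕ) = 0 + 1 from rfl, coeff_succ_X_mul]
      simp [hz0]
    have h2 := congrArg (fun f => coeff 0 (coeff 1 f)) h
    simp [outerSeries, innerSeries, coeff_C, h1, ht.ne'] at h2
  have key : (1 - rankOne z * W) * H = rankOne (1 + z) := by
    refine mul_left_cancel₀ (mul_ne_zero hne hP) ?_
    simp only [rankOne_apply, map_add, map_one] at *
    set x := outerSeries z
    set y := innerSeries z
    set a := (1 + x) ^ (q + 1) * (C (C t) + x) with ha
    set b := (1 + y) ^ (q + 1) * (C (C t) + y) with hb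
    rw [pow_succ] at ha hb
    linear_combination (H - (1 + x) * (1 + y)) * h2 - x * y * H * h3 + H * (b * hx - a * hy)
      + a * b * hHank - (1 + x) * b * hx + (1 + y) * a * hy
      + ((1 + x) * (1 + y) - H) * (x * hb - y * ha)
  have : H = rankOne (1 + z) * E := by
    linear_combination E * key - H * h1
  rw [this]
  exact (IsPSDKernel.of_mem (rankOne_mem _)).mul hE

end Kernel

section Moment
open Polynomial Filter Topology

theorem sum_choose_mul_bernsteinPolynomial (n j : ℕ) (h : j ≤ n) :
    ∑ k ∈ Finset.range (n + 1), C (k.choose j : ℝ) * bernsteinPolynomial ℝ n k =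
      C (n.choose j : ℝ) * X ^ j := by
  obtain ⟨m, rfl⟩ := Nat.exists_eq_add_of_le h
  rw [add_assoc, Finset.sum_range_add, Finset.sum_eq_zero, zero_add]
  · have h1 : ∀ i ∈ Finset.range (m + 1),
        C ((j + i).choose j : ℝ) * bernsteinPolynomial ℝ (j + m) (j + i) =
          C ((j + m).choose j : ℝ) * X ^ j * bernsteinPolynomial ℝ m i := by
      intro i hi
      have h2 := Nat.choose_mul (n := j + m) (k := j + i) (s := j) (by omega)
      simp only [Nat.add_sub_cancel_left] at h2
      have h3 : ((j + m).choose (j + i) : ℝ[X]) * ((j + i).choose j : ℝ[X]) =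
          ((j + m).choose j : ℝ[X]) * (m.choose i : ℝ[X]) := by exact_mod_cast h2
      simp only [bernsteinPolynomial, Nat.add_sub_add_left, map_natCast, pow_add]
      linear_combination X ^ j * X ^ i * (1 - X) ^ (m - i) * h3
    rw [Finset.sum_congr rfl h1, ← Finset.mul_sum, bernsteinPolynomial.sum, mul_one]
  · intro i hi
    simp [Nat.choose_eq_zero_of_lt (Finset.mem_range.1 hi)]

theorem tendsto_sum_bernstein (L : ℝ[X] →ₗ[ℝ] ℝ) (i j : ℕ) :
    Tendsto (fun n : ℕ => ∑ k ∈ Finset.range (n + 1), L (bernsteinPolynomial ℝ n k) *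
      (((k : ℝ) / n) ^ i * ((k.choose j : ℝ) / n.choose j))) atTop (𝓝 (L (X ^ (i + j)))) := by
  induction i generalizing j with
  | zero =>
    refine tendsto_const_nhds.congr' ?_
    filter_upwards [eventually_ge_atTop j] with n hn
    have h := congrArg L (sum_choose_mul_bernsteinPolynomial n j hn)
    have hne : (n.choose j : ℝ) ≠ 0 := by exact_mod_cast (Nat.choose_pos hn).ne'
    simp only [map_sum, ← smul_eq_C_mul, map_smul, smul_eq_mul] at h
    rw [zero_add, ← mul_right_inj' hne, ← h, Finset.mul_sum]
    refine Finset.sum_congr rfl fun k _ => ?_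
    field_simp
  | succ i ih =>
    have hj : Tendsto (fun n : ℕ => (j : ℝ) / n) atTop (𝓝 0) :=
      tendsto_const_div_atTop_nhds_zero_nat _
    have h := ((hj.const_sub 1).mul (ih (j + 1))).add (hj.mul (ih j))
    rw [sub_zero, one_mul, zero_mul, add_zero, ← add_assoc, add_right_comm] at h
    refine h.congr' ?_
    filter_upwards [eventually_ge_atTop (j + 1)] with n hn
    rw [Finset.mul_sum, Finset.mul_sum, ← Finset.sum_add_distrib]
    refine Finset.sum_congr rfl fun k _ => ?_
    have hn0 : (n : ℝ) ≠ 0 := by exact_mod_cast (by omega : n ≠ 0)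
    have hnj : (n : ℝ) - j ≠ 0 := by
      rw [sub_ne_zero]; exact_mod_cast (by omega : n ≠ j)
    have hj0 : (j : ℝ) + 1 ≠ 0 := by positivity
    have hne : (n.choose j : ℝ) ≠ 0 := by exact_mod_cast (Nat.choose_pos (by omega)).ne'
    have key : ∀ m : ℕ, ((m.choose (j + 1) : ℕ) : ℝ) = m.choose j * ((m : ℝ) - j) / (j + 1) := by
      intro m
      rw [eq_div_iff hj0]
      rcases lt_or_ge m j with hm | hm
      · simp [Nat.choose_eq_zero_of_lt hm, Nat.choose_eq_zero_of_lt (hm.trans j.lt_succ_self)]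
      · have := Nat.choose_succ_right_eq m j
        rw [← Nat.cast_sub hm]
        exact_mod_cast this
    have h1 : (1 - (j : ℝ) / n) * ((k.choose (j + 1) : ℝ) / n.choose (j + 1)) +
        j / n * ((k.choose j : ℝ) / n.choose j) = k / n * ((k.choose j : ℝ) / n.choose j) := by
      rw [key, key]
      field_simp
      ring
    rw [pow_succ]
    linear_combination L (bernsteinPolynomial ℝ n k) * ((k : ℝ) / n) ^ i * h1

/-- The **Hausdorff moment problem**. -/
theorem exists_probabilityMeasure_unitInterval (L : ℝ[X] →ₗ[ℝ] ℝ) (h1 : L 1 = 1)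
    (hpos : ∀ n k, 0 ≤ L (bernsteinPolynomial ℝ n k)) :
    ∃ μ : Measure unitInterval, IsProbabilityMeasure μ ∧
      ∀ p : ℝ[X], ∫ y, p.eval (y : ℝ) ∂μ = L p := by
  let w : ℕ → ℕ → ℝ := fun n k => L (bernsteinPolynomial ℝ n k)
  let pt : ℕ → ℕ → unitInterval := fun n k => Set.projIcc 0 1 zero_le_one ((k : ℝ) / n)
  let μ : ℕ → Measure unitInterval := fun n =>
    ∑ k ∈ Finset.range (n + 1), ENNReal.ofReal (w n k) • Measure.dirac (pt n k)
  have hμ : ∀ n, IsProbabilityMeasure (μ n) := by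
    intro n
    constructor
    simp only [μ, Measure.coe_finsetSum, Finset.sum_apply, Measure.smul_apply, measure_univ,
      smul_eq_mul, mul_one]
    rw [← ENNReal.ofReal_sum_of_nonneg fun k _ => hpos n k, ← map_sum, bernsteinPolynomial.sum,
      h1, ENNReal.ofReal_one]
  let P : ℕ → ProbabilityMeasure unitInterval := fun n => ⟨μ n, hμ n⟩
  obtain ⟨ν, -, hν⟩ := isCompact_univ.ultrafilter_le_nhds
    ((hyperfilter ℕ : Ultrafilter ℕ).map P) (by simp)
  have hν' : Tendsto P (hyperfilter ℕ : Filter ℕ) (𝓝 ν) := hν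
  rw [ProbabilityMeasure.tendsto_iff_forall_integral_tendsto] at hν'
  have hle : (hyperfilter ℕ : Filter ℕ) ≤ atTop := by
    rw [← Nat.cofinite_eq_atTop]; exact hyperfilter_le_cofinite
  have hmom : ∀ j : ℕ, ∫ y, (y : ℝ) ^ j ∂(ν : Measure unitInterval) = L (X ^ j) := by
    intro j
    have ha := hν' (BoundedContinuousFunction.mkOfCompact
      ⟨fun y : unitInterval => (y : ℝ) ^ j, by fun_prop⟩)
    refine tendsto_nhds_unique ha (((tendsto_sum_bernstein L j 0).mono_left hle).congr ?_)
    intro n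
    change _ = ∫ y, (y : ℝ) ^ j ∂(μ n)
    rw [integral_finsetSum_measure]
    · refine Finset.sum_congr rfl fun k hk => ?_
      rw [integral_smul_measure, integral_dirac, ENNReal.toReal_ofReal (hpos n k)]
      have hk' : k ≤ n := Nat.lt_succ_iff.1 (Finset.mem_range.1 hk)
      have : (pt n k : ℝ) = k / n := by
        simp only [pt]
        rw [Set.projIcc_of_mem]
        exact ⟨by positivity, div_le_one_of_le₀ (by exact_mod_cast hk') (by positivity)⟩
      simp [this]
    · intro k _
      exact (integrable_dirac (by simp)).smul_measure ENNReal.ofReal_ne_top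
  refine ⟨ν, inferInstance, fun p => ?_⟩
  have hint : ∀ p : ℝ[X], Integrable (fun y : unitInterval => p.eval (y : ℝ))
      (ν : Measure unitInterval) := fun p =>
    (BoundedContinuousFunction.mkOfCompact
      ⟨fun y : unitInterval => p.eval (y : ℝ), by fun_prop⟩).integrable _
  induction p using Polynomial.induction_on' with
  | add p q hp hq =>
    simp only [eval_add, map_add]
    rw [integral_add (hint p) (hint q), hp, hq]
  | monomial n a =>
    rw [← C_mul_X_pow_eq_monomial, ← smul_eq_C_mul, map_smul, ← hmom, smul_eq_mul,
      ← integral_const_mul]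
    simp

theorem bernsteinPolynomial_nonneg_of_sq (L : ℝ[X] →ₗ[ℝ] ℝ) (h1 : ∀ p, 0 ≤ L (p ^ 2))
    (h2 : ∀ p, 0 ≤ L (X * (1 - X) * p ^ 2)) (n k : ℕ) :
    0 ≤ L (bernsteinPolynomial ℝ n k) := by
  have h3 : ∀ p, 0 ≤ L (X * p ^ 2) := fun p => by
    rw [show X * p ^ 2 = (X * p) ^ 2 + X * (1 - X) * p ^ 2 by ring, map_add]
    exact add_nonneg (h1 _) (h2 _)
  have h4 : ∀ p, 0 ≤ L ((1 - X) * p ^ 2) := fun p => by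
    rw [show (1 - X) * p ^ 2 = ((1 - X) * p) ^ 2 + X * (1 - X) * p ^ 2 by ring, map_add]
    exact add_nonneg (h1 _) (h2 _)
  have h5 : ∀ a b, 0 ≤ L (X ^ a * (1 - X) ^ b) := by
    intro a b
    obtain ⟨a, rfl | rfl⟩ := Nat.even_or_odd' a <;> obtain ⟨b, rfl | rfl⟩ := Nat.even_or_odd' b
    · convert h1 (X ^ a * (1 - X) ^ b) using 2; ring
    · convert h4 (X ^ a * (1 - X) ^ b) using 2; ring
    · convert h3 (X ^ a * (1 - X) ^ b) using 2; ring
    · convert h2 (X ^ a * (1 - X) ^ b) using 2; ring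
  rw [bernsteinPolynomial, mul_assoc, ← map_natCast (C : ℝ →+* ℝ[X]), ← smul_eq_C_mul, map_smul]
  exact smul_nonneg (by positivity) (h5 _ _)

/-- A log-convex sequence that is `O(r ^ n)` has first ratio at most `r`. -/
theorem le_mul_of_logConvex_of_bound {a : ℕ → ℝ} {K r : ℝ} (hr : 0 < r) (h0 : ∀ n, 0 ≤ a n)
    (hlc : ∀ n, a (n + 1) ^ 2 ≤ a n * a (n + 2)) (hb : ∀ n, a n ≤ K * r ^ n) :
    a 1 ≤ r * a 0 := by
  by_contra! hlt
  have ha1 : 0 < a 1 := (mul_nonneg hr.le (h0 0)).trans_lt hlt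
  have ha0 : 0 < a 0 := by
    refine (h0 0).lt_of_ne' fun h => ?_
    have := hlc 0
    rw [h, zero_mul] at this
    exact absurd this (not_le.2 (by positivity))
  have hstep : ∀ n, 0 < a n ∧ a n * a 1 ≤ a (n + 1) * a 0 := by
    intro n
    induction n with
    | zero => exact ⟨ha0, by simp [mul_comm]⟩
    | succ n ih =>
      obtain ⟨hn, hn'⟩ := ih
      have hn1 : 0 < a (n + 1) := by
        refine pos_of_mul_pos_left ((mul_pos hn ha1).trans_le hn') ha0.le
      refine ⟨hn1, le_of_mul_le_mul_left ?_ hn⟩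
      calc a n * (a (n + 1) * a 1) = a (n + 1) * (a n * a 1) := by ring
        _ ≤ a (n + 1) * (a (n + 1) * a 0) := by gcongr
        _ = a (n + 1) ^ 2 * a 0 := by ring
        _ ≤ a n * a (n + 2) * a 0 := by gcongr; exact hlc n
        _ = a n * (a (n + 1 + 1) * a 0) := by ring
  have hgrow : ∀ n, a 0 * (a 1 / a 0) ^ n ≤ a n := by
    intro n
    induction n with
    | zero => simp
    | succ n ih =>
      calc a 0 * (a 1 / a 0) ^ (n + 1) = a 0 * (a 1 / a 0) ^ n * (a 1 / a 0) := by ring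
        _ ≤ a n * (a 1 / a 0) := by gcongr
        _ ≤ a (n + 1) := by
          rw [mul_div_assoc', div_le_iff₀ ha0]; exact (hstep n).2
  have hρ : 1 < a 1 / a 0 / r := by
    rw [div_div, lt_div_iff₀ (by positivity)]; linarith
  obtain ⟨n, hn⟩ := pow_unbounded_of_one_lt (K / a 0) hρ
  have := (hgrow n).trans (hb n)
  rw [div_pow, div_lt_div_iff₀ ha0 (by positivity)] at hn
  linarith

theorem mul_sq_nonneg_of_bound (L : ℝ[X] →ₗ[ℝ] ℝ) (hL : ∀ p, 0 ≤ L (p ^ 2)) {K R : ℝ}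
    (hR : 0 < R) (hb : ∀ n, |L (X ^ n)| ≤ K * R ^ n) (p : ℝ[X]) :
    0 ≤ L ((C (R ^ 2) - X ^ 2) * p ^ 2) := by
  have hbound : ∀ f : ℝ[X], ∃ K', ∀ n, |L (X ^ n * f)| ≤ K' * R ^ n := by
    intro f
    induction f using Polynomial.induction_on' with
    | add f g hf hg =>
      obtain ⟨A, hA⟩ := hf
      obtain ⟨B, hB⟩ := hg
      refine ⟨A + B, fun n => ?_⟩
      rw [mul_add, map_add, add_mul]
      exact (abs_add_le _ _).trans (add_le_add (hA n) (hB n))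
    | monomial m c =>
      refine ⟨|c| * (K * R ^ m), fun n => ?_⟩
      rw [← C_mul_X_pow_eq_monomial, mul_left_comm, ← pow_add, ← smul_eq_C_mul, map_smul,
        smul_eq_mul, abs_mul, mul_assoc, mul_assoc, ← pow_add, add_comm m]
      exact mul_le_mul_of_nonneg_left (hb _) (abs_nonneg c)
  obtain ⟨K', hK'⟩ := hbound (p ^ 2)
  have h := le_mul_of_logConvex_of_bound (a := fun n => L (X ^ (2 * n) * p ^ 2)) (K := K')
    (r := R ^ 2) (by positivity) (fun n => ?_) (fun n => ?_) (fun n => ?_)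
  · simp only [mul_one, mul_zero, pow_zero, one_mul] at h
    rw [sub_mul, map_sub, ← smul_eq_C_mul, map_smul, smul_eq_mul]
    linarith
  · convert hL (X ^ n * p) using 2; ring
  · have hq : ∀ s : ℝ, 0 ≤ L (X ^ (2 * (n + 2)) * p ^ 2) * (s * s) +
        2 * L (X ^ (2 * (n + 1)) * p ^ 2) * s + L (X ^ (2 * n) * p ^ 2) := by
      intro s
      have := hL (X ^ n * p + C s * (X ^ (n + 2) * p))
      have he : (X ^ n * p + C s * (X ^ (n + 2) * p)) ^ 2 = X ^ (2 * n) * p ^ 2 +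
          C (2 * s) * (X ^ (2 * (n + 1)) * p ^ 2) + C (s * s) * (X ^ (2 * (n + 2)) * p ^ 2) := by
        rw [C_mul, C_mul, show (C 2 : ℝ[X]) = 2 from rfl]
        ring
      rw [he, map_add, map_add, ← smul_eq_C_mul, ← smul_eq_C_mul, map_smul, map_smul,
        smul_eq_mul, smul_eq_mul] at this
      linarith
    have := discrim_le_zero hq
    rw [discrim] at this
    linarith
  · rw [← pow_mul]
    exact (le_abs_self _).trans (hK' _)

/-- The **Hamburger moment problem** for exponentially bounded sequences. -/
theorem exists_probabilityMeasure_of_moments {M : ℕ → ℝ} (hM0 : M 0 = 1)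
    (hpsd : ∀ (N : ℕ) (c : ℕ → ℝ),
      0 ≤ ∑ i ∈ Finset.range N, ∑ j ∈ Finset.range N, c i * c j * M (i + j))
    {K R : ℝ} (hR : 0 < R) (hb : ∀ n, |M n| ≤ K * R ^ n) :
    ∃ ν : Measure ℝ, IsProbabilityMeasure ν ∧ ν (Set.Icc (-R) R)ᶜ = 0 ∧
      ∀ n, ∫ x, x ^ n ∂ν = M n := by
  let L₀ : ℝ[X] →ₗ[ℝ] ℝ := Polynomial.lsum fun n => M n • LinearMap.id
  have hX : ∀ n, L₀ (X ^ n) = M n := fun n => by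
    simp [L₀, Polynomial.lsum_apply, ← monomial_one_right_eq_X_pow]
  have hsq : ∀ p, 0 ≤ L₀ (p ^ 2) := by
    intro p
    convert hpsd (p.natDegree + 1) p.coeff using 1
    conv_lhs => rw [p.as_sum_range_C_mul_X_pow, sq, Finset.sum_mul_sum]
    simp only [map_sum]
    refine Finset.sum_congr rfl fun i _ => Finset.sum_congr rfl fun j _ => ?_
    rw [mul_mul_mul_comm, ← C_mul, ← pow_add, ← smul_eq_C_mul, map_smul, hX, smul_eq_mul]
  have hloc := mul_sq_nonneg_of_bound L₀ hsq hR (by simpa only [hX] using hb)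
  let ℓ : ℝ[X] := C (2 * R)⁻¹ * (X + C R)
  let L : ℝ[X] →ₗ[ℝ] ℝ := L₀ ∘ₗ (aeval ℓ).toLinearMap
  have hLdef : ∀ p, L p = L₀ (aeval ℓ p) := fun _ => rfl
  have hℓ : C (2 * R) * ℓ = X + C R := by
    rw [← mul_assoc, ← C_mul, mul_inv_cancel₀ (by positivity), C_1, one_mul]
  obtain ⟨μ, hμ, hmom⟩ := exists_probabilityMeasure_unitInterval L
    (by rw [hLdef, map_one, ← pow_zero X, hX, hM0])
    (bernsteinPolynomial_nonneg_of_sq L (fun p => by rw [hLdef, map_pow]; exact hsq _)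
      (fun p => by
        have h1 : C ((2 * R) ^ 2) * (ℓ * (1 - ℓ)) = C (R ^ 2) - X ^ 2 := by
          have h2 : (C (2 * R) : ℝ[X]) = 2 * C R := by rw [C_mul]; rfl
          rw [C_pow, C_pow]
          linear_combination (C (2 * R) - C (2 * R) * ℓ - X - C R) * hℓ + (X + C R) * h2
        have h3 := hloc (aeval ℓ p)
        rw [← h1, mul_assoc, ← smul_eq_C_mul, map_smul, smul_eq_mul] at h3
        rw [hLdef]
        simp only [map_mul, map_sub, map_one, map_pow, aeval_X]
        exact nonneg_of_mul_nonneg_right h3 (by positivity)))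
  have hmeas : Measurable fun y : unitInterval => 2 * R * (y : ℝ) - R := by fun_prop
  refine ⟨μ.map fun y : unitInterval => 2 * R * (y : ℝ) - R,
    Measure.isProbabilityMeasure_map hmeas.aemeasurable, ?_, fun n => ?_⟩
  · rw [Measure.map_apply hmeas measurableSet_Icc.compl]
    convert measure_empty (μ := μ)
    ext y
    have h0 := y.2.1
    have h1 := y.2.2
    simp only [Set.mem_preimage, Set.mem_compl_iff, Set.mem_Icc, Set.mem_empty_iff_false,
      iff_false, not_not]
    constructor <;> nlinarith
  · rw [integral_map hmeas.aemeasurable (by fun_prop), ← hX]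
    have hXn : aeval ℓ ((C (2 * R) * X - C R) ^ n) = X ^ n := by
      rw [map_pow, map_sub, map_mul, aeval_X, aeval_C, aeval_C, algebraMap_eq, hℓ,
        add_sub_cancel_right]
    rw [← hXn, ← hLdef, ← hmom]
    simp

end Moment

section Fuss

theorem succ_mul_fussNarayana (q n k : ℕ) :
    ((n : ℝ) + 1) * fussNarayana q (n + 1) (k + 1) =
      (n + 1).choose (k + 1) * (q * (n + 1)).choose k := by
  have h : ((n : ℝ) + 1) * n.choose k = (n + 1).choose (k + 1) * (k + 1) := by
    exact_mod_cast Nat.add_one_mul_choose_eq n k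
  have hk : (k : ℝ) + 1 ≠ 0 := by positivity
  simp only [fussNarayana, Nat.add_sub_cancel, Nat.cast_add, Nat.cast_one]
  field_simp
  linear_combination ((q * (n + 1)).choose k : ℝ) * h

theorem coeff_pow_fussNarayana (q n : ℕ) (t : ℝ) :
    (((1 + Polynomial.X) ^ q * (Polynomial.C t + Polynomial.X)) ^ (n + 1)).coeff n =
      ((n : ℝ) + 1) * ∑ b ∈ Finset.Icc 1 (n + 1), fussNarayana q (n + 1) b * t ^ b := by
  rw [mul_pow, ← pow_mul, Polynomial.coeff_mul, Finset.mul_sum,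
    Finset.Nat.sum_antidiagonal_eq_sum_range_succ_mk, ← Finset.Ico_add_one_right_eq_Icc,
    Finset.sum_Ico_eq_sum_range]
  refine Finset.sum_congr rfl fun k hk => ?_
  have hk' : k ≤ n := Nat.lt_succ_iff.1 (Finset.mem_range.1 hk)
  rw [add_comm 1 k, ← mul_assoc, succ_mul_fussNarayana, Polynomial.coeff_one_add_X_pow,
    add_comm (Polynomial.C t), Polynomial.coeff_X_add_C_pow,
    ← Nat.choose_symm_of_eq_add (show n + 1 = (n - k) + (k + 1) by omega),
    show n + 1 - (n - k) = k + 1 by omega]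
  ring

theorem fussNarayana_nonneg (q n b : ℕ) : 0 ≤ fussNarayana q n b := by
  unfold fussNarayana; positivity

theorem fussNarayana_le (q n b : ℕ) : fussNarayana q n b ≤ 2 ^ n * 2 ^ (q * n) := by
  have h1 : 1 / (b : ℝ) ≤ 1 := by
    rcases b.eq_zero_or_pos with rfl | hb
    · simp
    · rw [div_le_one (by positivity)]; exact_mod_cast hb
  have h2 : ((n - 1).choose (b - 1) : ℝ) ≤ 2 ^ n := by
    exact_mod_cast (Nat.choose_le_two_pow _ _).trans (Nat.pow_le_pow_right two_pos (Nat.sub_le n 1))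
  have h3 : ((q * n).choose (b - 1) : ℝ) ≤ 2 ^ (q * n) := by
    exact_mod_cast Nat.choose_le_two_pow _ _
  calc fussNarayana q n b ≤ 1 * 2 ^ n * 2 ^ (q * n) := by unfold fussNarayana; gcongr
    _ = _ := by ring

theorem abs_sum_fussNarayana_le (q n : ℕ) {t : ℝ} (ht : 0 < t) :
    |∑ b ∈ Finset.Icc 1 n, fussNarayana q n b * t ^ b| ≤
      (2 * (2 * 2 ^ q * (1 + t))) ^ n := by
  rw [abs_of_nonneg (Finset.sum_nonneg fun b _ =>
    mul_nonneg (fussNarayana_nonneg q n b) (by positivity))]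
  calc ∑ b ∈ Finset.Icc 1 n, fussNarayana q n b * t ^ b
      ≤ ∑ b ∈ Finset.Icc 1 n, 2 ^ n * 2 ^ (q * n) * (1 + t) ^ n := by
        refine Finset.sum_le_sum fun b hb => ?_
        gcongr
        · exact fussNarayana_le q n b
        · calc t ^ b ≤ (1 + t) ^ b := by gcongr; linarith
            _ ≤ (1 + t) ^ n := pow_le_pow_right₀ (by linarith) (Finset.mem_Icc.1 hb).2
    _ = n * (2 ^ n * 2 ^ (q * n) * (1 + t) ^ n) := by simp
    _ ≤ 2 ^ n * (2 ^ n * 2 ^ (q * n) * (1 + t) ^ n) := by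
        gcongr; exact_mod_cast Nat.lt_two_pow_self.le
    _ = _ := by rw [mul_pow, mul_pow, mul_pow, ← pow_mul]

end Fuss

/-- **Free Poisson law of order `2q` with parameter `t`.** For every `q ≥ 1` and `t > 0`
there is a compactly supported probability measure on `ℝ` whose `n`-th moment is the
Fuss–Narayana polynomial `Σ_{b=1}^n F_q^b(n) t^b`, for every `n ≥ 1`. -/
theorem stmt5 (q : ℕ) (hq : 1 ≤ q) (t : ℝ) (ht : 0 < t) :
    ∃ ν : Measure ℝ, IsProbabilityMeasure ν ∧
      (∃ R : ℝ, ν (Set.Icc (-R) R)ᶜ = 0) ∧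
      ∀ n : ℕ, 1 ≤ n →
        ∫ x : ℝ, x ^ n ∂ν = ∑ b ∈ Finset.Icc 1 n, fussNarayana q n b * t ^ b := by
  let φ : Polynomial ℝ := (1 + Polynomial.X) ^ q * (Polynomial.C t + Polynomial.X)
  obtain ⟨z, hz⟩ := exists_powerSeries_fixedPoint φ
  have hφ : φ.aeval z = (1 + z) ^ q * (PowerSeries.C t + z) := by
    simp [φ]
  have hz0 : PowerSeries.constantCoeff z = 0 := by rw [hz]; simp
  have hM0 : PowerSeries.coeff 0 (1 + z) = 1 := by simp [hz0]
  have hM : ∀ n, 1 ≤ n → PowerSeries.coeff n (1 + z) =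
      ∑ b ∈ Finset.Icc 1 n, fussNarayana q n b * t ^ b := by
    intro n hn
    obtain ⟨n, rfl⟩ := Nat.exists_eq_add_of_le' hn
    have hne : (n : ℝ) + 1 ≠ 0 := by positivity
    rw [← mul_right_inj' hne, ← coeff_pow_fussNarayana, map_add, PowerSeries.coeff_one,
      if_neg n.succ_ne_zero, zero_add]
    exact lagrange_inversion φ hz n
  have hpsd : IsPSDKernel (PowerSeries.mk fun i => PowerSeries.mk fun j =>
      PowerSeries.coeff (i + j) (1 + z)) := by
    obtain ⟨q, rfl⟩ := Nat.exists_eq_add_of_le' hq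
    exact isPSDKernel_hankel ht q (by rwa [hφ] at hz)
  obtain ⟨ν, hν, hsupp, hmom⟩ := exists_probabilityMeasure_of_moments
    (M := fun n => PowerSeries.coeff n (1 + z)) hM0
    (fun N c => by simpa only [PowerSeries.coeff_mk] using hpsd.quadratic_nonneg N c)
    (K := 1) (R := 2 * (2 * 2 ^ q * (1 + t))) (by positivity) (fun n => by
      rcases n.eq_zero_or_pos with rfl | hn
      · simp [hz0]
      · rw [hM n hn, one_mul]
        exact abs_sum_fussNarayana_le q n ht)
  exact ⟨ν, hν, ⟨_, hsupp⟩, fun n hn => (hmom n).trans (hM n hn)⟩
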